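/- arXiv:2503.10203 — 5 statements merged into one kernel-verified Lean document; each statement's English description precedes it below -/
import Mathlib

section
/- There exists a point x* in the integer feasible set Ω_int (in particular, x* has exactly n nonzero entries, one per block, each equal to 1) such that f(x*) ≤ f(x) for every x in the relaxed feasible set Ω_rel. Consequently x* is simultaneously a global minimizer of f over Ω_rel and over Ω_int. -/
open Finset

/-- The CPD objective `f(x) = ∑_{i<j} ∑_r ∑_s b i j r s * x i r * x j s + ∑_i ∑_r a i r * x i r`. -/
noncomputable def cpdObj {n : ℕ} {l : Fin n → ℕ}
    (a : (i : Fin n) → Fin (l i) → ℝ)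
    (b : (i j : Fin n) → Fin (l i) → Fin (l j) → ℝ)
    (x : (i : Fin n) → Fin (l i) → ℝ) : ℝ :=
  (∑ i, ∑ j, if i < j then ∑ r, ∑ s, b i j r s * x i r * x j s else 0)
    + ∑ i, ∑ r, a i r * x i r

/-- The relaxed feasible set `Ω_rel`. -/
def relFeas {n : ℕ} (l : Fin n → ℕ) : Set ((i : Fin n) → Fin (l i) → ℝ) :=
  {x | (∀ i r, 0 ≤ x i r) ∧ ∀ i, ∑ r, x i r = 1}

/-- The integer (0/1) feasible set `Ω_int`. -/
def intFeas {n : ℕ} (l : Fin n → ℕ) : Set ((i : Fin n) → Fin (l i) → ℝ) :=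
  {x | x ∈ relFeas l ∧ ∀ i r, x i r = 0 ∨ x i r = 1}

/-- The vertex of the product of simplices attached to a choice function. -/
noncomputable def cpdVert {n : ℕ} {l : Fin n → ℕ} (σ : (i : Fin n) → Fin (l i)) :
    (i : Fin n) → Fin (l i) → ℝ := fun i => Pi.single (σ i) 1

/-- The objective is affine in each block. -/
lemma cpdObj_block {n : ℕ} {l : Fin n → ℕ}
    (a : (i : Fin n) → Fin (l i) → ℝ)
    (b : (i j : Fin n) → Fin (l i) → Fin (l j) → ℝ)
    (x : (i : Fin n) → Fin (l i) → ℝ) (i : Fin n) (hx : ∑ r, x i r = 1) :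
    cpdObj a b x = ∑ t, x i t * cpdObj a b (Function.update x i (Pi.single t 1)) := by
  have hcoord : ∀ p r, ∑ t, x i t * (Function.update x i (Pi.single t (1 : ℝ)) p r) = x p r := by
    intro p r
    by_cases hp : p = i
    · subst hp
      simp [Pi.single_apply]
    · simp [Function.update_of_ne hp, ← Finset.sum_mul, hx]
  have hpair : ∀ p q r s, p ≠ q → ∑ t, x i t * (Function.update x i (Pi.single t (1 : ℝ)) p r
      * Function.update x i (Pi.single t (1 : ℝ)) q s) = x p r * x q s := by
    intro p q r s hpq
    by_cases hp : p = i
    · have hq : q ≠ i := fun h => hpq (hp.trans h.symm)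
      simp only [Function.update_of_ne hq, ← mul_assoc]
      rw [← Finset.sum_mul, hcoord]
    · simp only [Function.update_of_ne hp]
      rw [← hcoord q s, Finset.mul_sum]
      exact Finset.sum_congr rfl fun t _ => by ring
  unfold cpdObj
  simp only [mul_add, Finset.sum_add_distrib]
  congr 1
  · simp only [Finset.mul_sum]
    refine Eq.trans ?_ Finset.sum_comm
    refine Finset.sum_congr rfl fun p _ => ?_
    refine Eq.trans ?_ Finset.sum_comm
    refine Finset.sum_congr rfl fun q _ => ?_
    split_ifs with h
    · simp only [Finset.mul_sum]
      refine Eq.trans ?_ Finset.sum_comm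
      refine Finset.sum_congr rfl fun r _ => ?_
      refine Eq.trans ?_ Finset.sum_comm
      refine Finset.sum_congr rfl fun s _ => ?_
      rw [mul_assoc, ← hpair p q r s h.ne, Finset.mul_sum]
      exact Finset.sum_congr rfl fun t _ => by ring
    · simp
  · simp only [Finset.mul_sum]
    refine Eq.trans ?_ Finset.sum_comm
    refine Finset.sum_congr rfl fun p _ => ?_
    refine Eq.trans ?_ Finset.sum_comm
    refine Finset.sum_congr rfl fun r _ => ?_
    rw [← hcoord p r, Finset.mul_sum]
    exact Finset.sum_congr rfl fun t _ => by ring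

/-- One block can be rounded without increasing the objective. -/
lemma cpdObj_round {n : ℕ} {l : Fin n → ℕ}
    (a : (i : Fin n) → Fin (l i) → ℝ)
    (b : (i j : Fin n) → Fin (l i) → Fin (l j) → ℝ)
    (x : (i : Fin n) → Fin (l i) → ℝ) (hx : x ∈ relFeas l) (i : Fin n) :
    ∃ t, cpdObj a b (Function.update x i (Pi.single t 1)) ≤ cpdObj a b x := by
  by_contra! h
  have h1 := cpdObj_block a b x i (hx.2 i)
  have h2 : ∑ t, x i t * cpdObj a b x = cpdObj a b x := by
    rw [← Finset.sum_mul, hx.2 i, one_mul]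
  have h3 : ∑ t, x i t * cpdObj a b x
      < ∑ t, x i t * cpdObj a b (Function.update x i (Pi.single t 1)) := by
    refine Finset.sum_lt_sum
      (fun t _ => mul_le_mul_of_nonneg_left (h t).le (hx.1 i t)) ?_
    have : ∃ t ∈ Finset.univ, 0 < x i t := by
      apply Finset.exists_lt_of_sum_lt
      simp [hx.2 i]
    obtain ⟨t, ht, hpos⟩ := this
    exact ⟨t, ht, mul_lt_mul_of_pos_left (h t) hpos⟩
  linarith

/-- All blocks of a finite set can be rounded. -/
lemma cpdObj_round_all {n : ℕ} {l : Fin n → ℕ}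
    (a : (i : Fin n) → Fin (l i) → ℝ)
    (b : (i j : Fin n) → Fin (l i) → Fin (l j) → ℝ)
    (x : (i : Fin n) → Fin (l i) → ℝ) (hx : x ∈ relFeas l) (S : Finset (Fin n)) :
    ∃ y ∈ relFeas l, (∀ i ∈ S, ∃ t, y i = Pi.single t 1) ∧ cpdObj a b y ≤ cpdObj a b x := by
  induction S using Finset.induction_on with
  | empty => exact ⟨x, hx, by simp, le_rfl⟩
  | insert i S hi ih =>
    obtain ⟨y, hy, hS, hle⟩ := ih
    obtain ⟨t, ht⟩ := cpdObj_round a b y hy i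
    refine ⟨_, ⟨fun p r => ?_, fun p => ?_⟩, fun p hp => ?_, ht.trans hle⟩
    · by_cases h : p = i
      · subst h
        rw [Function.update_self, Pi.single_apply]
        split_ifs <;> norm_num
      · rw [Function.update_of_ne h]
        exact hy.1 p r
    · by_cases h : p = i
      · subst h
        simp
      · rw [Function.update_of_ne h]
        exact hy.2 p
    · by_cases h : p = i
      · subst h
        exact ⟨t, by simp⟩
      · rw [Function.update_of_ne h]
        exact hS p (Finset.mem_of_mem_insert_of_ne hp h)

/-- there is an integer-feasible point that globally minimizes `f`
over the relaxed feasible set (hence also over the integer feasible set). -/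
theorem cpd_exists_integer_global_minimizer
    (n : ℕ) (hn : 1 ≤ n) (l : Fin n → ℕ) (hl : ∀ i, 1 ≤ l i)
    (a : (i : Fin n) → Fin (l i) → ℝ)
    (b : (i j : Fin n) → Fin (l i) → Fin (l j) → ℝ) :
    ∃ xstar ∈ intFeas l,
      (∀ x ∈ relFeas l, cpdObj a b xstar ≤ cpdObj a b x) ∧
      (∀ x ∈ intFeas l, cpdObj a b xstar ≤ cpdObj a b x) := by
  have : ∀ i, Nonempty (Fin (l i)) := fun i => ⟨⟨0, hl i⟩⟩
  obtain ⟨σ, hσ⟩ := Finite.exists_min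
    (fun σ : (i : Fin n) → Fin (l i) => cpdObj a b (cpdVert σ))
  have hrel : ∀ x ∈ relFeas l, cpdObj a b (cpdVert σ) ≤ cpdObj a b x := by
    intro x hx
    obtain ⟨y, -, hy, hle⟩ := cpdObj_round_all a b x hx Finset.univ
    choose τ hτ using fun i => hy i (Finset.mem_univ i)
    have : y = cpdVert τ := funext hτ
    subst this
    exact (hσ τ).trans hle
  refine ⟨cpdVert σ, ⟨⟨fun i r => ?_, fun i => ?_⟩, fun i r => ?_⟩, hrel,
    fun x hx => hrel x hx.1⟩
  · simp only [cpdVert, Pi.single_apply]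
    split_ifs <;> norm_num
  · simp [cpdVert]
  · simp only [cpdVert, Pi.single_apply]
    split_ifs <;> simp
end

section
/- For every x in the relaxed feasible set Ω_rel there exists y in the integer feasible set Ω_int with f(y) ≤ f(x). In particular the infimum of f over Ω_rel equals the infimum of f over Ω_int. -/
open Finset

/-- `F` is affine on the hyperplane `∑ v = 1`. -/
def CpdAff {m : ℕ} (F : (Fin m → ℝ) → ℝ) : Prop :=
  ∀ v : Fin m → ℝ, ∑ r, v r = 1 → F v = ∑ r, v r * F (Pi.single r 1)

lemma CpdAff.const {m : ℕ} (c : ℝ) : CpdAff (fun _ : Fin m → ℝ => c) := by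
  intro v hv
  simp only
  rw [← Finset.sum_mul, hv, one_mul]

lemma CpdAff.coord {m : ℕ} (s : Fin m) : CpdAff (fun v : Fin m → ℝ => v s) := by
  intro v _
  simp [Pi.single_apply]

lemma CpdAff.add {m : ℕ} {F G : (Fin m → ℝ) → ℝ} (hF : CpdAff F) (hG : CpdAff G) :
    CpdAff (fun v => F v + G v) := by
  intro v hv
  simp only [mul_add, Finset.sum_add_distrib]
  rw [← hF v hv, ← hG v hv]

lemma CpdAff.cmul {m : ℕ} {F : (Fin m → ℝ) → ℝ} (c : ℝ) (hF : CpdAff F) :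
    CpdAff (fun v => c * F v) := by
  intro v hv
  simp only [mul_left_comm _ c, ← Finset.mul_sum]
  rw [← hF v hv]

lemma CpdAff.sum {m : ℕ} {ι : Type*} (s : Finset ι) {F : ι → (Fin m → ℝ) → ℝ}
    (hF : ∀ i, CpdAff (F i)) : CpdAff (fun v => ∑ i ∈ s, F i v) := by
  intro v hv
  simp only [Finset.mul_sum]
  rw [Finset.sum_comm]
  exact Finset.sum_congr rfl fun i _ => hF i v hv

lemma CpdAff.upd {n : ℕ} {l : Fin n → ℕ} (x : (i : Fin n) → Fin (l i) → ℝ) (k i : Fin n)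
    (r : Fin (l i)) : CpdAff (fun v => Function.update x k v i r) := by
  by_cases h : i = k
  · subst h
    simpa using CpdAff.coord r
  · simpa [Function.update_of_ne h] using CpdAff.const (x i r)

lemma CpdAff.obj {n : ℕ} {l : Fin n → ℕ}
    (a : (i : Fin n) → Fin (l i) → ℝ)
    (b : (i j : Fin n) → Fin (l i) → Fin (l j) → ℝ)
    (x : (i : Fin n) → Fin (l i) → ℝ) (k : Fin n) :
    CpdAff (fun v => cpdObj a b (Function.update x k v)) := by
  unfold cpdObj
  refine CpdAff.add ?_ ?_
  · refine CpdAff.sum _ fun i => CpdAff.sum _ fun j => ?_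
    by_cases hij : i < j
    · simp only [hij, if_true]
      refine CpdAff.sum _ fun r => CpdAff.sum _ fun s => ?_
      by_cases h : i = k
      · have hj : j ≠ k := fun h' => by rw [h, h'] at hij; exact lt_irrefl _ hij
        have := CpdAff.cmul (b i j r s * x j s) (CpdAff.upd x k i r)
        simpa only [Function.update_of_ne hj, mul_right_comm] using this
      · have := CpdAff.cmul (b i j r s * x i r) (CpdAff.upd x k j s)
        simpa only [Function.update_of_ne h] using this
    · simp only [hij, if_false]
      exact CpdAff.const 0
  · exact CpdAff.sum _ fun i => CpdAff.sum _ fun r => CpdAff.cmul _ (CpdAff.upd x k i r)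

lemma CpdAff.exists_le {m : ℕ} {F : (Fin m → ℝ) → ℝ} (hF : CpdAff F) (v : Fin m → ℝ)
    (h0 : ∀ r, 0 ≤ v r) (h1 : ∑ r, v r = 1) : ∃ r, F (Pi.single r 1) ≤ F v := by
  have hne : (Finset.univ : Finset (Fin m)).Nonempty := by
    rw [Finset.nonempty_iff_ne_empty]
    intro h
    rw [h] at h1
    simp at h1
  obtain ⟨r, _, hr⟩ := Finset.exists_min_image Finset.univ (fun r => F (Pi.single r 1)) hne
  refine ⟨r, ?_⟩
  rw [hF v h1]
  calc F (Pi.single r 1) = ∑ s, v s * F (Pi.single r 1) := by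
        rw [← Finset.sum_mul, h1, one_mul]
    _ ≤ _ := Finset.sum_le_sum fun s hs => mul_le_mul_of_nonneg_left (hr s hs) (h0 s)

lemma cpd_round {n : ℕ} {l : Fin n → ℕ}
    (a : (i : Fin n) → Fin (l i) → ℝ)
    (b : (i j : Fin n) → Fin (l i) → Fin (l j) → ℝ)
    (x : (i : Fin n) → Fin (l i) → ℝ) (hx : x ∈ relFeas l) (s : Finset (Fin n)) :
    ∃ y ∈ relFeas l, (∀ i ∈ s, ∀ r, y i r = 0 ∨ y i r = 1) ∧ cpdObj a b y ≤ cpdObj a b x := by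
  induction s using Finset.induction_on with
  | empty => exact ⟨x, hx, by simp, le_rfl⟩
  | insert k s _ ih =>
    obtain ⟨y, hy, hys, hle⟩ := ih
    obtain ⟨r, hr⟩ := (CpdAff.obj a b y k).exists_le (y k) (hy.1 k) (hy.2 k)
    simp only [Function.update_eq_self] at hr
    refine ⟨_, ⟨?_, ?_⟩, ?_, hr.trans hle⟩
    · intro i t
      by_cases h : i = k
      · subst h
        simp only [Function.update_self, Pi.single_apply]
        split_ifs <;> norm_num
      · simpa only [Function.update_of_ne h] using hy.1 i t
    · intro i
      by_cases h : i = k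
      · subst h
        simp
      · simpa only [Function.update_of_ne h] using hy.2 i
    · intro i hi t
      by_cases h : i = k
      · subst h
        simp only [Function.update_self, Pi.single_apply]
        split_ifs <;> norm_num
      · simpa only [Function.update_of_ne h] using
          hys i ((Finset.mem_insert.1 hi).resolve_left h) t

/-- every relaxed-feasible point is dominated by an integer-feasible
point, and the two infima coincide. -/
theorem cpd_integer_point_dominates_and_inf_eq
    (n : ℕ) (hn : 1 ≤ n) (l : Fin n → ℕ) (hl : ∀ i, 1 ≤ l i)
    (a : (i : Fin n) → Fin (l i) → ℝ)
    (b : (i j : Fin n) → Fin (l i) → Fin (l j) → ℝ) :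
    (∀ x ∈ relFeas l, ∃ y ∈ intFeas l, cpdObj a b y ≤ cpdObj a b x) ∧
      sInf (cpdObj a b '' relFeas l) = sInf (cpdObj a b '' intFeas l) := by
  have key : ∀ x ∈ relFeas l, ∃ y ∈ intFeas l, cpdObj a b y ≤ cpdObj a b x := by
    intro x hx
    obtain ⟨y, hy, h, hle⟩ := cpd_round a b x hx Finset.univ
    exact ⟨y, ⟨hy, fun i => h i (Finset.mem_univ i)⟩, hle⟩
  refine ⟨key, ?_⟩
  have hsub : cpdObj a b '' intFeas l ⊆ cpdObj a b '' relFeas l :=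
    Set.image_mono fun x hx => hx.1
  have hlb : ∀ c ∈ lowerBounds (cpdObj a b '' intFeas l),
      c ∈ lowerBounds (cpdObj a b '' relFeas l) := by
    rintro c hc _ ⟨x, hx, rfl⟩
    obtain ⟨y, hy, hle⟩ := key x hx
    exact (hc ⟨y, hy, rfl⟩).trans hle
  rcases (relFeas l).eq_empty_or_nonempty with he | ⟨x, hx⟩
  · have : cpdObj a b '' intFeas l = ∅ := by
      rw [he, Set.image_empty] at hsub
      exact Set.subset_empty_iff.1 hsub
    rw [this, he, Set.image_empty]
  · obtain ⟨y, hy, -⟩ := key x hx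
    by_cases hbd : BddBelow (cpdObj a b '' intFeas l)
    · obtain ⟨c, hc⟩ := hbd
      apply le_antisymm
      · exact csInf_le_csInf ⟨c, hlb c hc⟩ ⟨_, y, hy, rfl⟩ hsub
      · exact le_csInf ⟨_, x, hx, rfl⟩ (hlb _ fun z hz => csInf_le ⟨c, hc⟩ hz)
    · rw [Real.sInf_of_not_bddBelow hbd,
        Real.sInf_of_not_bddBelow fun h => hbd (h.mono hsub)]
end

section
/- One rounding step preserves global optimality: if x is a global minimizer of f over the relaxed feasible set Ω_rel, j : Fin n is a block index, and s⁰ : Fin (l j) satisfies x j s⁰ > 0, then the point update(x, j, e_{s⁰}) (block j replaced by the indicator of s⁰, all other blocks unchanged) is also a global minimizer of f over Ω_rel. -/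
open Finset

lemma cpdObj_affine {n : ℕ} {l : Fin n → ℕ}
    (a : (i : Fin n) → Fin (l i) → ℝ)
    (b : (i j : Fin n) → Fin (l i) → Fin (l j) → ℝ)
    (x : (i : Fin n) → Fin (l i) → ℝ) (j : Fin n) (u w : Fin (l j) → ℝ) (t : ℝ) :
    cpdObj a b (Function.update x j (fun r => u r + t * (u r - w r))) =
      cpdObj a b (Function.update x j u) +
        t * (cpdObj a b (Function.update x j u) - cpdObj a b (Function.update x j w)) := by
  have key : ∀ A B C D E F : ℝ, A = B + t * (B - C) → D = E + t * (E - F) →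
      A + D = (B + E) + t * ((B + E) - (C + F)) := by
    intro A B C D E F h1 h2
    rw [h1, h2]; ring
  unfold cpdObj
  apply key
  · simp only [← Finset.sum_sub_distrib, Finset.mul_sum, ← Finset.sum_add_distrib]
    refine Finset.sum_congr rfl fun i _ => Finset.sum_congr rfl fun k _ => ?_
    split_ifs with hik
    · simp only [← Finset.sum_sub_distrib, Finset.mul_sum, ← Finset.sum_add_distrib]
      refine Finset.sum_congr rfl fun r _ => Finset.sum_congr rfl fun s _ => ?_
      by_cases hi : i = j
      · subst hi
        have hk : k ≠ i := ne_of_gt hik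
        simp only [Function.update_self, Function.update_of_ne hk]
        ring
      · by_cases hk : k = j
        · subst hk
          simp only [Function.update_self, Function.update_of_ne hi]
          ring
        · simp only [Function.update_of_ne hk, Function.update_of_ne hi]
          ring
    · simp
  · simp only [← Finset.sum_sub_distrib, Finset.mul_sum, ← Finset.sum_add_distrib]
    refine Finset.sum_congr rfl fun i _ => Finset.sum_congr rfl fun r _ => ?_
    by_cases hi : i = j
    · subst hi
      simp only [Function.update_self]
      ring
    · simp only [Function.update_of_ne hi]
      ring

lemma update_mem_relFeas {n : ℕ} {l : Fin n → ℕ}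
    (x : (i : Fin n) → Fin (l i) → ℝ) (hx : x ∈ relFeas l) (j : Fin n) (v : Fin (l j) → ℝ)
    (h0 : ∀ r, 0 ≤ v r) (h1 : ∑ r, v r = 1) : Function.update x j v ∈ relFeas l := by
  refine ⟨fun i r => ?_, fun i => ?_⟩
  · by_cases hi : i = j
    · subst hi
      simpa only [Function.update_self] using h0 r
    · simpa only [Function.update_of_ne hi] using hx.1 i r
  · by_cases hi : i = j
    · subst hi
      simpa only [Function.update_self] using h1
    · simpa only [Function.update_of_ne hi] using hx.2 i

/-- one rounding step preserves global optimality over `Ω_rel`. -/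
theorem cpd_rounding_step_preserves_optimality
    (n : ℕ) (hn : 1 ≤ n) (l : Fin n → ℕ) (hl : ∀ i, 1 ≤ l i)
    (a : (i : Fin n) → Fin (l i) → ℝ)
    (b : (i j : Fin n) → Fin (l i) → Fin (l j) → ℝ)
    (x : (i : Fin n) → Fin (l i) → ℝ) (hx : x ∈ relFeas l)
    (hmin : ∀ y ∈ relFeas l, cpdObj a b x ≤ cpdObj a b y)
    (j : Fin n) (s0 : Fin (l j)) (hs0 : 0 < x j s0) :
    Function.update x j (fun r => if r = s0 then (1 : ℝ) else 0) ∈ relFeas l ∧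
      ∀ y ∈ relFeas l,
        cpdObj a b (Function.update x j (fun r => if r = s0 then (1 : ℝ) else 0)) ≤
          cpdObj a b y := by
  have he1 : ∑ r, (if r = s0 then (1 : ℝ) else 0) = 1 := by simp
  refine ⟨update_mem_relFeas x hx j _ (fun r => by split_ifs <;> norm_num) he1,
    fun y hy => le_trans ?_ (hmin y hy)⟩
  have haff := cpdObj_affine a b x j (x j) (fun r => if r = s0 then (1 : ℝ) else 0) (x j s0)
  rw [Function.update_eq_self] at haff
  have hv := hmin _ (update_mem_relFeas x hx j
    (fun r => x j r + x j s0 * (x j r - (if r = s0 then (1 : ℝ) else 0))) (fun r => by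
      have := hx.1 j r
      split_ifs with h
      · subst h
        nlinarith
      · nlinarith) (by
      rw [Finset.sum_add_distrib, ← Finset.mul_sum, Finset.sum_sub_distrib, he1, hx.2 j]
      ring))
  rw [haff] at hv
  by_contra hc
  push Not at hc
  nlinarith
end

section
/- Simplex projection via thresholding: let k ≥ 1 and y ∈ ℝ^k. There exists a unique real number t̂ such that ∑_{i=1}^k max(y_i − t̂, 0) = 1, and the vector v with v_i = max(y_i − t̂, 0) is the unique minimizer of the Euclidean distance ‖v − y‖ over the standard simplex Δ_k = {v ∈ ℝ^k : v_i ≥ 0 for all i, ∑_i v_i = 1}; that is, v is the Euclidean projection of y onto Δ_k. -/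
open Finset

theorem thresh_anti {k : ℕ} (y : Fin k → ℝ) (a b : ℝ) (hab : a < b)
    (ha : ∑ i, max (y i - a) 0 = 1) (hb : ∑ i, max (y i - b) 0 = 1) : False := by
  have hpos : ∃ i ∈ (Finset.univ : Finset (Fin k)), 0 < max (y i - b) 0 := by
    apply Finset.exists_lt_of_sum_lt
    rw [hb]; simp
  obtain ⟨j, -, hj⟩ := hpos
  have : ∑ i, max (y i - b) 0 < ∑ i, max (y i - a) 0 := by
    apply Finset.sum_lt_sum
    · intro i _
      exact max_le_max (by linarith) le_rfl
    · refine ⟨j, Finset.mem_univ _, ?_⟩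
      have h1 : 0 < y j - b := by
        rcases lt_max_iff.1 hj with h | h
        · exact h
        · exact absurd h (lt_irrefl _)
      rw [max_eq_left h1.le, max_eq_left (by linarith)]
      linarith
  linarith

theorem thresh_ineq {k : ℕ} (y : Fin k → ℝ) (t : ℝ) (ht : ∑ i, max (y i - t) 0 = 1)
    (w : Fin k → ℝ) (hw : ∀ i, 0 ≤ w i) (hs : ∑ i, w i = 1) :
    ∑ i, (max (y i - t) 0 - y i) ^ 2 + ∑ i, (w i - max (y i - t) 0) ^ 2
      ≤ ∑ i, (w i - y i) ^ 2 := by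
  have h : ∑ i, ((max (y i - t) 0 - y i) ^ 2 + (w i - max (y i - t) 0) ^ 2
      - 2 * t * (w i - max (y i - t) 0)) ≤ ∑ i, (w i - y i) ^ 2 := by
    apply Finset.sum_le_sum
    intro i _
    have := hw i
    rcases le_total (y i - t) 0 with h | h
    · rw [max_eq_right h]
      nlinarith [mul_nonneg this (sub_nonneg.2 h)]
    · rw [max_eq_left h]
      nlinarith
  rw [Finset.sum_sub_distrib, Finset.sum_add_distrib, ← Finset.mul_sum,
    Finset.sum_sub_distrib, ht, hs] at h
  linarith

/-- simplex projection via thresholding. -/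
theorem simplex_projection_by_thresholding (k : ℕ) (hk : 1 ≤ k) (y : Fin k → ℝ) :
    ∃ t : ℝ,
      (∑ i, max (y i - t) 0 = 1) ∧
      (∀ t' : ℝ, (∑ i, max (y i - t') 0 = 1) → t' = t) ∧
      (∀ i, 0 ≤ max (y i - t) 0) ∧
      (∑ i, max (y i - t) 0 = 1) ∧
      (∀ w : Fin k → ℝ, (∀ i, 0 ≤ w i) → (∑ i, w i = 1) →
        Real.sqrt (∑ i, (max (y i - t) 0 - y i) ^ 2) ≤
          Real.sqrt (∑ i, (w i - y i) ^ 2)) ∧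
      (∀ w : Fin k → ℝ, (∀ i, 0 ≤ w i) → (∑ i, w i = 1) →
        Real.sqrt (∑ i, (w i - y i) ^ 2) = Real.sqrt (∑ i, (max (y i - t) 0 - y i) ^ 2) →
        w = fun i => max (y i - t) 0) := by
  have hex : ∃ t : ℝ, ∑ i, max (y i - t) 0 = 1 := by
    haveI : Nonempty (Fin k) := ⟨⟨0, hk⟩⟩
    obtain ⟨m, hm⟩ := Finite.exists_max y
    have hc : Continuous (fun t : ℝ => ∑ i, max (y i - t) 0) := by fun_prop
    have h0 : ∑ i, max (y i - y m) 0 = 0 :=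
      Finset.sum_eq_zero fun i _ => max_eq_right (by linarith [hm i])
    have h1 : 1 ≤ ∑ i, max (y i - (y m - 1)) 0 := by
      have := Finset.single_le_sum (f := fun i => max (y i - (y m - 1)) 0)
        (fun i _ => le_max_right _ _) (Finset.mem_univ m)
      refine le_trans ?_ this
      exact le_max_of_le_left (by linarith)
    obtain ⟨t, ht⟩ := mem_range_of_exists_le_of_exists_ge hc
      (c := 1) ⟨y m, by simp only [h0]; norm_num⟩ ⟨y m - 1, h1⟩
    exact ⟨t, ht⟩
  obtain ⟨t, ht⟩ := hex
  refine ⟨t, ht, ?_, fun i => le_max_right _ _, ht, ?_, ?_⟩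
  · intro t' ht'
    rcases lt_trichotomy t' t with h | h | h
    · exact (thresh_anti y _ _ h ht' ht).elim
    · exact h
    · exact (thresh_anti y _ _ h ht ht').elim
  · intro w hw hs
    apply Real.sqrt_le_sqrt
    have h := thresh_ineq y t ht w hw hs
    have : 0 ≤ ∑ i, (w i - max (y i - t) 0) ^ 2 := Finset.sum_nonneg fun i _ => sq_nonneg _
    linarith
  · intro w hw hs he
    have h := thresh_ineq y t ht w hw hs
    rw [Real.sqrt_inj (Finset.sum_nonneg fun i _ => sq_nonneg _)
      (Finset.sum_nonneg fun i _ => sq_nonneg _)] at he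
    have h0 : ∑ i, (w i - max (y i - t) 0) ^ 2 = 0 :=
      le_antisymm (by linarith) (Finset.sum_nonneg fun i _ => sq_nonneg _)
    rw [Finset.sum_eq_zero_iff_of_nonneg (fun i _ => sq_nonneg _)] at h0
    funext i
    have := h0 i (Finset.mem_univ i)
    exact sub_eq_zero.1 (pow_eq_zero_iff (two_ne_zero) |>.1 this)
end

section
/- Constraint-violation bound for the quadratic penalty method: assume all coefficients are nonnegative, i.e. a i r ≥ 0 and b i j r s ≥ 0 for all indices. Let h(x) = ∑_{i=1}^n (∑_r x i r − 1)², let σ > 0, let Ω_P = {x : x i r ≥ 0 for all i, r}, let x_σ ∈ Ω_P be a global minimizer of f + (σ/2) h over Ω_P, and let x̄ be any point of the relaxed feasible set Ω_rel. Then h(x_σ) ≤ 2 f(x̄)/σ. -/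
open Finset

/-- The quadratic penalty `h(x) = ∑ i, (∑ r, x i r - 1)^2` for the block-sum
constraints. -/
noncomputable def cpdPenalty {n : ℕ} {l : Fin n → ℕ}
    (x : (i : Fin n) → Fin (l i) → ℝ) : ℝ :=
  ∑ i, (∑ r, x i r - 1) ^ 2

/-- The nonnegative orthant `Ω_P`. -/
def nonnegOrthant {n : ℕ} (l : Fin n → ℕ) : Set ((i : Fin n) → Fin (l i) → ℝ) :=
  {x | ∀ i r, 0 ≤ x i r}

/-- constraint-violation bound for the quadratic penalty method. -/
theorem cpd_penalty_violation_bound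
    (n : ℕ) (hn : 1 ≤ n) (l : Fin n → ℕ) (hl : ∀ i, 1 ≤ l i)
    (a : (i : Fin n) → Fin (l i) → ℝ)
    (b : (i j : Fin n) → Fin (l i) → Fin (l j) → ℝ)
    (ha : ∀ i r, 0 ≤ a i r) (hb : ∀ i j r s, 0 ≤ b i j r s)
    (σ : ℝ) (hσ : 0 < σ)
    (xσ : (i : Fin n) → Fin (l i) → ℝ) (hxσ : xσ ∈ nonnegOrthant l)
    (hmin : ∀ y ∈ nonnegOrthant l,
      cpdObj a b xσ + σ / 2 * cpdPenalty xσ ≤ cpdObj a b y + σ / 2 * cpdPenalty y)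
    (xbar : (i : Fin n) → Fin (l i) → ℝ) (hxbar : xbar ∈ relFeas l) :
    cpdPenalty xσ ≤ 2 * cpdObj a b xbar / σ := by
  have h1 := hmin xbar hxbar.1
  have h2 : cpdPenalty xbar = 0 := by
    unfold cpdPenalty
    exact Finset.sum_eq_zero fun i _ => by rw [hxbar.2 i]; norm_num
  have h3 : 0 ≤ cpdObj a b xσ := by
    unfold cpdObj
    refine add_nonneg (Finset.sum_nonneg fun i _ => Finset.sum_nonneg fun j _ => ?_)
      (Finset.sum_nonneg fun i _ => Finset.sum_nonneg fun r _ => mul_nonneg (ha i r) (hxσ i r))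
    split_ifs
    · exact Finset.sum_nonneg fun r _ => Finset.sum_nonneg fun s _ =>
        mul_nonneg (mul_nonneg (hb i j r s) (hxσ i r)) (hxσ j s)
    · exact le_rfl
  rw [h2] at h1
  rw [le_div_iff₀ hσ]
  linarith
end
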